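/- Let K ≥ 1 and P ≥ 1 be integers, σ_N² > 0, σ_X² > 0, and D > σ_N²/K. Consider all choices of reals D₁, …, D_P with D_p > σ_N²/K and Σ_{p=1}^P D_p ≤ P·D, together with nonnegative reals r_{k,p} (1 ≤ k ≤ K, 1 ≤ p ≤ P) satisfying Σ_{k=1}^K (1 − exp(−2·r_{k,p})) = σ_N²/D_p for every p. Over all such choices, the minimum of Σ_{p=1}^P [ Σ_{k=1}^K r_{k,p} + (1/2)·ln(1 + σ_X²/D_p) ] equals P·[ −(K/2)·ln(1 − σ_N²/(K·D)) + (1/2)·ln(1 + σ_X²/D) ], and it is attained by D_p = D and r_{k,p} = −(1/2)·ln(1 − σ_N²/(K·D)) for all k and p. -/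

import Mathlib

theorem aux_tan (c x y : ℝ) (hc : 0 < c) (hx : 0 < x) (hy : 0 < y) :
    Real.log (1 + c / y) + c / (y * (y + c)) * (y - x) ≤ Real.log (1 + c / x) := by
  have h1 : 0 < 1 + c / x := by positivity
  have h2 : 0 < 1 + c / y := by positivity
  have h := Real.log_le_sub_one_of_pos (div_pos h2 h1)
  rw [Real.log_div h2.ne' h1.ne'] at h
  have e : 1 - (1 + c / y) / (1 + c / x) - c / (y * (y + c)) * (y - x)
      = c * (y - x) ^ 2 / (y * (y + c) * (x + c)) := by
    field_simp
    ring
  have e2 : 0 ≤ c * (y - x) ^ 2 / (y * (y + c) * (x + c)) := by positivity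
  linarith

theorem aux_log (a x : ℝ) (hx : a < x) (ha : 0 < a) :
    -Real.log (1 - a / x) = Real.log (1 + a / (x - a)) := by
  have h0 : 0 < x := by linarith
  have h1 : 0 < x - a := by linarith
  rw [← Real.log_inv]
  congr 1
  have : 1 - a / x = (x - a) / x := by field_simp
  rw [this]
  field_simp
  ring

theorem aux_rate (K : ℕ) (hK : 1 ≤ K) (m : ℝ) (hm : 0 < m) (r : Fin K → ℝ)
    (h : ∑ k, (1 - Real.exp (-2 * r k)) = K * (1 - m)) :
    (K : ℝ) / 2 * (-Real.log m) ≤ ∑ k, r k := by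
  have key : ∀ k, (1 / 2) * (-Real.log m) + (1 / (2 * m)) * ((1 - Real.exp (-2 * r k)) - (1 - m))
      ≤ r k := by
    intro k
    have h1 := Real.log_le_sub_one_of_pos (div_pos (Real.exp_pos (-2 * r k)) hm)
    rw [Real.log_div (Real.exp_pos _).ne' hm.ne', Real.log_exp] at h1
    have e : (1 / (2 * m)) * ((1 - Real.exp (-2 * r k)) - (1 - m))
        = (1 - Real.exp (-2 * r k) / m) / 2 := by
      field_simp
      ring
    rw [e]
    linarith
  have := Finset.sum_le_sum (fun k (_ : k ∈ Finset.univ) => key k)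
  rw [Finset.sum_add_distrib, ← Finset.mul_sum, ← Finset.mul_sum, Finset.sum_sub_distrib _ (fun _ => 1 - m), h] at this
  simp only [Finset.sum_const, Finset.card_univ, Fintype.card_fin, nsmul_eq_mul] at this
  linarith

/-- Corollary 1 (symmetric case): the minimum of the Berger–Tung sum rate
`∑_p [∑_k r_{k,p} + (1/2) ln(1 + σ_X²/D_p)]` over distortion allocations `D_p`
and nonnegative quantization rates `r_{k,p}` satisfying the constraints equals
`P[-(K/2) ln(1 - σ_N²/(KD)) + (1/2) ln(1 + σ_X²/D)]`, attained by `D_p = D`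
and `r_{k,p} = -(1/2) ln(1 - σ_N²/(KD))`. -/
theorem stmt_12 (K P : ℕ) (hK : 1 ≤ K) (hP : 1 ≤ P) (σN2 σX2 D : ℝ)
    (hN : 0 < σN2) (hX : 0 < σX2) (hD : σN2 / K < D) :
    IsLeast
      {S : ℝ | ∃ (Dp : Fin P → ℝ) (r : Fin K → Fin P → ℝ),
        (∀ p, σN2 / K < Dp p) ∧ (∑ p, Dp p ≤ (P : ℝ) * D) ∧ (∀ k p, 0 ≤ r k p) ∧
        (∀ p, (∑ k, (1 - Real.exp (-2 * r k p))) = σN2 / Dp p) ∧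
        S = ∑ p, ((∑ k, r k p) + (1 / 2) * Real.log (1 + σX2 / Dp p))}
      ((P : ℝ) * (-((K : ℝ) / 2) * Real.log (1 - σN2 / (K * D))
        + (1 / 2) * Real.log (1 + σX2 / D))) ∧
    (∑ _p : Fin P, ((∑ _k : Fin K, -(1 / 2 : ℝ) * Real.log (1 - σN2 / (K * D)))
        + (1 / 2) * Real.log (1 + σX2 / D)))
      = (P : ℝ) * (-((K : ℝ) / 2) * Real.log (1 - σN2 / (K * D))
        + (1 / 2) * Real.log (1 + σX2 / D)) := by
  have hK0 : (0 : ℝ) < K := by exact_mod_cast hK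
  have ha : 0 < σN2 / K := by positivity
  have hD0 : 0 < D := ha.trans hD
  have eN : ∀ x : ℝ, σN2 / (K * x) = σN2 / K / x := fun x => by rw [div_div]
  have hm : ∀ x : ℝ, σN2 / K < x → 0 < 1 - σN2 / K / x := by
    intro x hx
    have := (div_lt_one (ha.trans hx)).2 hx
    linarith
  have hsum : (∑ _p : Fin P, ((∑ _k : Fin K, -(1 / 2 : ℝ) * Real.log (1 - σN2 / (K * D)))
        + (1 / 2) * Real.log (1 + σX2 / D)))
      = (P : ℝ) * (-((K : ℝ) / 2) * Real.log (1 - σN2 / (K * D))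
        + (1 / 2) * Real.log (1 + σX2 / D)) := by
    simp only [Finset.sum_const, Finset.card_univ, Fintype.card_fin, nsmul_eq_mul]
    ring
  refine ⟨⟨⟨fun _ => D, fun _ _ => -(1 / 2 : ℝ) * Real.log (1 - σN2 / (K * D)),
    fun _ => hD, ?_, ?_, ?_, hsum.symm⟩, ?_⟩, hsum⟩
  · simp
  · intro _ _
    have h1 := hm D hD
    rw [eN]
    have : Real.log (1 - σN2 / K / D) ≤ 0 := by
      apply Real.log_nonpos h1.le
      have : 0 < σN2 / K / D := by positivity
      linarith
    linarith
  · intro _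
    have h1 := hm D hD
    rw [eN]
    have : -2 * (-(1 / 2 : ℝ) * Real.log (1 - σN2 / K / D)) = Real.log (1 - σN2 / K / D) := by ring
    beta_reduce
    rw [this, Real.exp_log h1]
    simp only [Finset.sum_const, Finset.card_univ, Fintype.card_fin, nsmul_eq_mul]
    field_simp
    ring
  · rintro S ⟨Dp, r, h1, h2, h3, h4, rfl⟩
    obtain ⟨a, hadef⟩ : ∃ a, a = σN2 / K := ⟨_, rfl⟩
    simp only [eN]
    simp only [← hadef] at h1 hm hD ha ⊢
    have hDa : 0 < D - a := by linarith
    obtain ⟨C, hC⟩ : ∃ C, C = (K : ℝ) / 2 * (a / ((D - a) * ((D - a) + a)))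
      + 1 / 2 * (σX2 / (D * (D + σX2))) := ⟨_, rfl⟩
    have hC0 : 0 ≤ C := by rw [hC]; positivity
    have key : ∀ p, (-((K : ℝ) / 2) * Real.log (1 - a / D) + (1 / 2) * Real.log (1 + σX2 / D))
        + C * (D - Dp p) ≤ (∑ k, r k p) + (1 / 2) * Real.log (1 + σX2 / Dp p) := by
      intro p
      have hp := h1 p
      have hp0 : 0 < Dp p := ha.trans hp
      have q1 := aux_rate K hK (1 - a / Dp p) (hm _ hp) (fun k => r k p) (by
        rw [h4 p, hadef]
        field_simp
        ring)
      have q2 := aux_tan σX2 (Dp p) D hX hp0 hD0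
      have q3 := aux_tan a (Dp p - a) (D - a) ha (by linarith) hDa
      rw [← aux_log a _ hp ha, ← aux_log a _ hD ha] at q3
      have q4 := mul_le_mul_of_nonneg_left q3 (by positivity : (0 : ℝ) ≤ (K : ℝ) / 2)
      have q5 : C * (D - Dp p) = (K : ℝ) / 2 * (a / ((D - a) * ((D - a) + a)) * (D - a - (Dp p - a)))
          + 1 / 2 * (σX2 / (D * (D + σX2)) * (D - Dp p)) := by
        rw [hC]; ring
      rw [q5]
      linarith
    have := Finset.sum_le_sum (fun p (_ : p ∈ Finset.univ) => key p)
    rw [Finset.sum_add_distrib, ← Finset.mul_sum, Finset.sum_sub_distrib] at this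
    simp only [Finset.sum_const, Finset.card_univ, Fintype.card_fin, nsmul_eq_mul] at this
    have h5 : 0 ≤ C * ((P : ℝ) * D - ∑ p, Dp p) := mul_nonneg hC0 (by linarith)
    linarith
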